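/- Let m ≥ 3 be an odd integer, let i be a positive integer with gcd(i,m) = 1, set q = 2^i and d = q² + q + 1. Then the number of elements a ∈ 𝔽_{2^m}^* such that both G_a and H_a are almost perfect nonlinear (APN) on 𝔽_{2^m}³ is at least (2^m + 1 − (d−1)(d−2)·√(2^m) − d)/d (an inequality of real numbers). -/

import Mathlib

/-- The trivariate map `G_a(x,y,z) = (x^{q+1}+a x^q z + y z^q, x^q z + y^{q+1},
x y^q + a y^q z + z^{q+1})`. -/
def Gmap {F : Type*} [Field F] (q : ℕ) (a : F) : F × F × F → F × F × F :=
  fun v =>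
    (v.1 ^ (q + 1) + a * v.1 ^ q * v.2.2 + v.2.1 * v.2.2 ^ q,
     v.1 ^ q * v.2.2 + v.2.1 ^ (q + 1),
     v.1 * v.2.1 ^ q + a * v.2.1 ^ q * v.2.2 + v.2.2 ^ (q + 1))

/-- The trivariate map `H_a(x,y,z) = (x^{q+1}+a x y^q + y z^q, x y^q + z^{q+1},
x^q z + y^{q+1} + a y^q z)`. -/
def Hmap {F : Type*} [Field F] (q : ℕ) (a : F) : F × F × F → F × F × F :=
  fun v =>
    (v.1 ^ (q + 1) + a * v.1 * v.2.1 ^ q + v.2.1 * v.2.2 ^ q,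
     v.1 * v.2.1 ^ q + v.2.2 ^ (q + 1),
     v.1 ^ q * v.2.2 + v.2.1 ^ (q + 1) + a * v.2.1 ^ q * v.2.2)

/-- A function on `F³` is almost perfect nonlinear (APN) if every nontrivial
derivative equation `f(x+u) + f(x) = b` has at most two solutions. -/
def IsAPN {F : Type*} [Field F] (f : F × F × F → F × F × F) : Prop :=
  ∀ u : F × F × F, u ≠ 0 → ∀ b : F × F × F,
    {x : F × F × F | f (x + u) + f x = b}.ncard ≤ 2

/-- The additive polynomial `X^{q³} + a X^{q²} + X` has no nonzero root; here `σ` is `x ↦ x^q`. -/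
def KernelFree {F : Type*} [Field F] (σ : F →+* F) (a : F) : Prop :=
  ∀ x : F, x ≠ 0 → σ (σ (σ x)) + a * σ (σ x) + x ≠ 0

section Kernel

variable {F : Type*} [Field F] {σ : F →+* F}

theorem KernelFree.no_root (hσ : ∀ w : F, w ≠ 0 → ∃ x : F, x ≠ 0 ∧ σ x = x * w) {a : F}
    (h : KernelFree σ a) (w : F) : σ (σ w) * σ w * w + a * σ w * w + 1 ≠ 0 := by
  intro hw
  have hw0 : w ≠ 0 := by
    rintro rfl
    simp at hw
  obtain ⟨x, hx, hxw⟩ := hσ w hw0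
  apply h x hx
  simp only [hxw, map_mul]
  linear_combination x * hw

theorem KernelFree.no_root_adjoint [Finite F] [CharP F 2]
    (hσ : ∀ w : F, w ≠ 0 → ∃ x : F, x ≠ 0 ∧ σ x = x * w)
    (l : F →+ ZMod 2) (hlσ : ∀ x, l (σ x) = l x) (hl : ∀ x : F, x ≠ 0 → ∃ y, l (x * y) ≠ 0)
    {a : F} (h : KernelFree σ a) (w : F) : σ (σ w) * σ w * w + σ a * w + 1 ≠ 0 := by
  intro hw
  have hw0 : w ≠ 0 := by
    rintro rfl
    simp at hw
  obtain ⟨y, hy, hyw⟩ := hσ w hw0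
  have hy' : σ (σ (σ y)) + σ a * σ y + y = 0 := by
    simp only [hyw, map_mul]
    linear_combination y * hw
  let T : F →+ F :=
    { toFun := fun z => σ (σ (σ z)) + a * σ (σ z) + z
      map_zero' := by simp
      map_add' := fun s t => by simp only [map_add]; ring }
  have hT : Function.Surjective T := by
    rw [← Finite.injective_iff_surjective, injective_iff_map_eq_zero]
    intro x hx
    by_contra hx0
    exact h x hx0 hx
  obtain ⟨s, hs⟩ := hl y hy
  obtain ⟨z, rfl⟩ := hT s
  apply hs
  have key : l (σ (σ (σ z)) * (σ (σ (σ y)) + σ a * σ y + y)) = 0 := by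
    rw [hy', mul_zero, map_zero]
  have e : σ (σ (σ z)) * (σ (σ (σ y)) + σ a * σ y + y)
      = σ (σ (σ (z * y))) + σ (σ (σ z) * a * y) + σ (σ (σ z)) * y := by
    simp only [map_mul]; ring
  rw [e, map_add, map_add, hlσ, hlσ, hlσ, hlσ, ← map_add, ← map_add] at key
  rw [← key]
  congr 1
  change y * (σ (σ (σ z)) + a * σ (σ z) + z) = _
  ring

end Kernel

section Bilinear

/-- Two covectors annihilating a pair of independent vectors are proportional. -/
theorem minors_eq_zero_or_cross_eq_zero {F : Type*} [Field F] {x y z α β γ c₁ c₂ c₃ e₁ e₂ e₃ : F}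
    (hcx : c₁ * x + c₂ * y + c₃ * z = 0) (hcα : c₁ * α + c₂ * β + c₃ * γ = 0)
    (hex : e₁ * x + e₂ * y + e₃ * z = 0) (heα : e₁ * α + e₂ * β + e₃ * γ = 0) :
    (c₁ * e₂ = c₂ * e₁ ∧ c₁ * e₃ = c₃ * e₁ ∧ c₂ * e₃ = c₃ * e₂) ∨
      (x * β = y * α ∧ x * γ = z * α ∧ y * γ = z * β) := by
  by_cases h₁ : x * β = y * α
  · by_cases h₂ : x * γ = z * α
    · by_cases h₃ : y * γ = z * β
      · exact Or.inr ⟨h₁, h₂, h₃⟩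
      · left
        have := sub_ne_zero.mpr h₃
        refine ⟨?_, ?_, ?_⟩ <;> apply mul_left_cancel₀ this <;> grind
    · left
      have := sub_ne_zero.mpr h₂
      refine ⟨?_, ?_, ?_⟩ <;> apply mul_left_cancel₀ this <;> grind
  · left
    have := sub_ne_zero.mpr h₁
    refine ⟨?_, ?_, ?_⟩ <;> apply mul_left_cancel₀ this <;> grind

theorem exists_smul_of_cross_eq_zero {F : Type*} [Field F] {x y z α β γ : F}
    (hu : ¬(α = 0 ∧ β = 0 ∧ γ = 0)) (h₁ : x * β = y * α) (h₂ : x * γ = z * α)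
    (h₃ : y * γ = z * β) : ∃ t, x = t * α ∧ y = t * β ∧ z = t * γ := by
  by_cases hα : α = 0
  · by_cases hβ : β = 0
    · have hγ : γ ≠ 0 := fun hγ => hu ⟨hα, hβ, hγ⟩
      refine ⟨z / γ, ?_, ?_, ?_⟩ <;> field_simp <;> grind
    · refine ⟨y / β, ?_, ?_, ?_⟩ <;> field_simp <;> grind
  · refine ⟨x / α, ?_, ?_, ?_⟩ <;> field_simp <;> grind

variable {F : Type*} [Field F] [CharP F 2] {σ : F →+* F}

theorem gmap_ne_zero {a α β γ : F}
    (ha : ∀ w, σ (σ w) * σ w * w + a * σ w * w + 1 ≠ 0) (hu : ¬(α = 0 ∧ β = 0 ∧ γ = 0)) :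
    ¬(σ α * α + a * σ α * γ + β * σ γ = 0 ∧ σ α * γ + σ β * β = 0 ∧
      α * σ β + a * σ β * γ + σ γ * γ = 0) := by
  rintro ⟨h₁, h₂, h₃⟩
  by_cases hβ : β = 0
  · subst hβ
    simp only [map_zero, mul_zero, zero_mul, add_zero, zero_add, mul_eq_zero, map_eq_zero,
      or_self] at h₁ h₂ h₃
    subst h₃
    simp_all
  · have hα : α ≠ 0 := by
      rintro rfl
      simp_all
    have hσα : σ α ≠ 0 := by simpa using hα
    have hσβ : σ β ≠ 0 := by simpa using hβ
    have hσσα : σ (σ α) ≠ 0 := by simpa using hα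
    have hσσβ : σ (σ β) ≠ 0 := by simpa using hβ
    have hγ : γ = σ β * β / σ α := by
      field_simp
      grind
    apply ha (β / α)
    simp only [map_div₀]
    rw [hγ] at h₁
    simp only [map_div₀, map_mul] at h₁
    field_simp at h₁ ⊢
    grind

theorem hmap_ne_zero {a α β γ : F}
    (ha : ∀ w, σ (σ w) * σ w * w + a * w + 1 ≠ 0) (hu : ¬(α = 0 ∧ β = 0 ∧ γ = 0)) :
    ¬(σ α * α + a * α * σ β + β * σ γ = 0 ∧ α * σ β + σ γ * γ = 0 ∧
      σ α * γ + σ β * β + a * σ β * γ = 0) := by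
  rintro ⟨h₁, h₂, h₃⟩
  by_cases hγ : γ = 0
  · subst hγ
    simp only [map_zero, mul_zero, add_zero, zero_add, mul_eq_zero, map_eq_zero,
      or_self] at h₁ h₂ h₃
    subst h₃
    simp_all
  · have hβ : β ≠ 0 := by
      rintro rfl
      simp_all
    have hσγ : σ γ ≠ 0 := by simpa using hγ
    have hσβ : σ β ≠ 0 := by simpa using hβ
    have hσσγ : σ (σ γ) ≠ 0 := by simpa using hγ
    have hσσβ : σ (σ β) ≠ 0 := by simpa using hβ
    have hα : α = σ γ * γ / σ β := by
      field_simp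
      grind
    apply ha (γ / β)
    simp only [map_div₀]
    rw [hα] at h₃
    simp only [map_div₀, map_mul] at h₃
    field_simp at h₃ ⊢
    grind

theorem gmap_polar_eq_zero {a α β γ x y z : F}
    (ha : ∀ w, σ (σ w) * σ w * w + a * σ w * w + 1 ≠ 0)
    (ha' : ∀ w, σ (σ w) * σ w * w + σ a * w + 1 ≠ 0)
    (hfix : ∀ x, σ x = x → x = 0 ∨ x = 1)
    (hu : ¬(α = 0 ∧ β = 0 ∧ γ = 0))
    (h₁ : σ x * (α + a * γ) + σ α * (x + a * z) + y * σ γ + β * σ z = 0)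
    (h₂ : σ x * γ + σ α * z + σ y * β + y * σ β = 0)
    (h₃ : σ β * (x + a * z) + (α + a * γ) * σ y + σ z * γ + z * σ γ = 0) :
    (x = 0 ∧ y = 0 ∧ z = 0) ∨ (x = α ∧ y = β ∧ z = γ) := by
  have hG := gmap_ne_zero ha hu
  set G₁ := σ α * α + a * σ α * γ + β * σ γ with hG₁
  set G₂ := σ α * γ + σ β * β with hG₂
  set G₃ := α * σ β + a * σ β * γ + σ γ * γ with hG₃
  have e₁ : G₂ * x + G₃ * y + (G₁ + a * G₂) * z = 0 := by grind
  have e₂ : G₃ * σ x + G₁ * σ y + G₂ * σ z = 0 := by grind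
  have e₃ : G₂ * α + G₃ * β + (G₁ + a * G₂) * γ = 0 := by grind
  have e₄ : G₃ * σ α + G₁ * σ β + G₂ * σ γ = 0 := by grind
  have f₁ := congrArg σ e₁
  have f₃ := congrArg σ e₃
  simp only [map_add, map_mul, map_zero] at f₁ f₃
  rcases minors_eq_zero_or_cross_eq_zero e₂ e₄ f₁ f₃ with ⟨k₁, k₂, k₃⟩ | ⟨k₁, k₂, k₃⟩
  · exfalso
    by_cases hz : G₂ = 0
    · have hG₃0 : G₃ = 0 := by simpa [hz] using k₁
      have hG₁0 : G₁ = 0 := by simpa [hz, hG₃0] using k₃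
      exact hG ⟨hG₁0, hz, hG₃0⟩
    · have hσ : σ G₂ ≠ 0 := by simpa using hz
      have hσσ : σ (σ G₂) ≠ 0 := by simpa using hz
      apply ha' (G₃ / G₂)
      have hG₁' : G₁ = G₃ * σ G₃ / σ G₂ := by
        field_simp
        grind
      clear_value G₁ G₂ G₃
      subst hG₁'
      simp only [map_div₀, map_mul] at k₂ ⊢
      field_simp at k₂ ⊢
      grind
  · have k₁' : x * β = y * α := σ.injective (by simpa using k₁)
    have k₂' : x * γ = z * α := σ.injective (by simpa using k₂)
    have k₃' : y * γ = z * β := σ.injective (by simpa using k₃)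
    obtain ⟨t, rfl, rfl, rfl⟩ := exists_smul_of_cross_eq_zero hu k₁' k₂' k₃'
    have ht : σ t = t := by
      by_contra hne
      have hne' : σ t + t ≠ 0 := fun h => hne (by grind)
      simp only [map_mul] at h₁ h₂ h₃
      apply hG
      refine ⟨?_, ?_, ?_⟩ <;> apply mul_left_cancel₀ hne' <;> grind
    rcases hfix t ht with rfl | rfl
    · simp
    · simp

theorem hmap_polar_eq_zero {a α β γ x y z : F}
    (ha : ∀ w, σ (σ w) * σ w * w + a * σ w * w + 1 ≠ 0)
    (ha' : ∀ w, σ (σ w) * σ w * w + a * w + 1 ≠ 0)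
    (hfix : ∀ x, σ x = x → x = 0 ∨ x = 1)
    (hu : ¬(α = 0 ∧ β = 0 ∧ γ = 0))
    (h₁ : α * (σ x + a * σ y) + β * σ z + (σ α + a * σ β) * x + σ γ * y = 0)
    (h₂ : α * σ y + γ * σ z + σ β * x + σ γ * z = 0)
    (h₃ : γ * (σ x + a * σ y) + β * σ y + (σ α + a * σ β) * z + σ β * y = 0) :
    (x = 0 ∧ y = 0 ∧ z = 0) ∨ (x = α ∧ y = β ∧ z = γ) := by
  have hG := hmap_ne_zero ha' hu
  set H₁ := σ α * α + a * α * σ β + β * σ γ with hH₁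
  set H₂ := α * σ β + σ γ * γ with hH₂
  set H₃ := σ α * γ + σ β * β + a * σ β * γ with hH₃
  have e₁ : H₃ * x + H₂ * y + H₁ * z = 0 := by grind
  have e₂ : H₂ * σ x + (a * H₂ + H₁) * σ y + H₃ * σ z = 0 := by grind
  have e₃ : H₃ * α + H₂ * β + H₁ * γ = 0 := by grind
  have e₄ : H₂ * σ α + (a * H₂ + H₁) * σ β + H₃ * σ γ = 0 := by grind
  have f₁ := congrArg σ e₁
  have f₃ := congrArg σ e₃
  simp only [map_add, map_mul, map_zero] at f₁ f₃
  rcases minors_eq_zero_or_cross_eq_zero e₂ e₄ f₁ f₃ with ⟨k₁, k₂, k₃⟩ | ⟨k₁, k₂, k₃⟩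
  · exfalso
    by_cases hz : H₁ = 0
    · rw [hz, map_zero, mul_zero] at k₂
      have hH₃0 : H₃ = 0 := by simpa using k₂.symm
      have hH₂0 : H₂ = 0 := by simpa [hz, hH₃0] using k₁
      exact hG ⟨hz, hH₂0, hH₃0⟩
    · have hσ : σ H₁ ≠ 0 := by simpa using hz
      have hσσ : σ (σ H₁) ≠ 0 := by simpa using hz
      apply ha (H₃ / H₁)
      have hH₂' : H₂ = H₃ * σ H₃ / σ H₁ := by
        field_simp
        grind
      clear_value H₁ H₂ H₃
      subst hH₂'
      simp only [map_div₀, map_mul] at k₃ ⊢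
      field_simp at k₃ ⊢
      grind
  · have k₁' : x * β = y * α := σ.injective (by simpa using k₁)
    have k₂' : x * γ = z * α := σ.injective (by simpa using k₂)
    have k₃' : y * γ = z * β := σ.injective (by simpa using k₃)
    obtain ⟨t, rfl, rfl, rfl⟩ := exists_smul_of_cross_eq_zero hu k₁' k₂' k₃'
    have ht : σ t = t := by
      by_contra hne
      have hne' : σ t + t ≠ 0 := fun h => hne (by grind)
      simp only [map_mul] at h₁ h₂ h₃
      apply hG
      refine ⟨?_, ?_, ?_⟩ <;> apply mul_left_cancel₀ hne' <;> grind
    rcases hfix t ht with rfl | rfl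
    · simp
    · simp

end Bilinear

section APN

theorem isAPN_of_forall {F : Type*} [Field F] {f : F × F × F → F × F × F}
    (h : ∀ u : F × F × F, u ≠ 0 → ∀ x δ, f (x + δ + u) + f (x + δ) = f (x + u) + f x →
      δ = 0 ∨ δ = u) : IsAPN f := by
  intro u hu b
  rcases Set.eq_empty_or_nonempty {x | f (x + u) + f x = b} with he | ⟨x, hx⟩
  · simp [he]
  · refine (Set.ncard_le_ncard (t := {x, x + u}) ?_ (Set.toFinite _)).trans
      ((Set.ncard_insert_le _ _).trans (by rw [Set.ncard_singleton]))
    intro x' hx'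
    have hs : x + (x' - x) = x' := by abel
    rcases h u hu x (x' - x) (by rw [hs, hx, hx']) with h0 | h0
    · left
      exact sub_eq_zero.mp h0
    · right
      rw [Set.mem_singleton_iff, ← h0, hs]

variable {F : Type*} [Field F] [CharP F 2] {σ : F →+* F}

theorem isAPN_gmap {q : ℕ} (hq : ∀ x, σ x = x ^ q) {a : F}
    (ha : ∀ w, σ (σ w) * σ w * w + a * σ w * w + 1 ≠ 0)
    (ha' : ∀ w, σ (σ w) * σ w * w + σ a * w + 1 ≠ 0)
    (hfix : ∀ x, σ x = x → x = 0 ∨ x = 1) : IsAPN (Gmap q a) := by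
  apply isAPN_of_forall
  rintro ⟨α, β, γ⟩ hu ⟨r, s, t⟩ ⟨x, y, z⟩ h
  simp only [Gmap, pow_succ, ← hq, Prod.mk_add_mk, Prod.mk.injEq, map_add] at h
  obtain ⟨h₁, h₂, h₃⟩ := h
  have := gmap_polar_eq_zero (x := x) (y := y) (z := z) ha ha' hfix
    (show ¬(α = 0 ∧ β = 0 ∧ γ = 0) by simpa using hu) (by grind) (by grind) (by grind)
  simpa [Prod.ext_iff] using this

theorem isAPN_hmap {q : ℕ} (hq : ∀ x, σ x = x ^ q) {a : F}
    (ha : ∀ w, σ (σ w) * σ w * w + a * σ w * w + 1 ≠ 0)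
    (ha' : ∀ w, σ (σ w) * σ w * w + a * w + 1 ≠ 0)
    (hfix : ∀ x, σ x = x → x = 0 ∨ x = 1) : IsAPN (Hmap q a) := by
  apply isAPN_of_forall
  rintro ⟨α, β, γ⟩ hu ⟨r, s, t⟩ ⟨x, y, z⟩ h
  simp only [Hmap, pow_succ, ← hq, Prod.mk_add_mk, Prod.mk.injEq, map_add] at h
  obtain ⟨h₁, h₂, h₃⟩ := h
  have := hmap_polar_eq_zero (x := x) (y := y) (z := z) ha ha' hfix
    (show ¬(α = 0 ∧ β = 0 ∧ γ = 0) by simpa using hu) (by grind) (by grind) (by grind)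
  simpa [Prod.ext_iff] using this

end APN

section Power

variable {F : Type*} [Field F] [Fintype F]

theorem pow_injOn_of_coprime {n : ℕ} (hn : n.Coprime (Fintype.card F - 1)) {x y : F}
    (hx : x ≠ 0) (hy : y ≠ 0) (h : x ^ n = y ^ n) : x = y := by
  classical
  have hc : (Nat.card Fˣ).Coprime n := by
    rw [Nat.card_eq_fintype_card, Fintype.card_units]
    exact hn.symm
  have := (powCoprime hc).injective (a₁ := Units.mk0 x hx) (a₂ := Units.mk0 y hy)
    (by ext; simpa using h)
  simpa using congrArg Units.val this

theorem exists_pow_eq_of_coprime {n : ℕ} (hn : n.Coprime (Fintype.card F - 1)) {x : F}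
    (hx : x ≠ 0) : ∃ y : F, y ≠ 0 ∧ y ^ n = x := by
  classical
  have hc : (Nat.card Fˣ).Coprime n := by
    rw [Nat.card_eq_fintype_card, Fintype.card_units]
    exact hn.symm
  obtain ⟨y, hy⟩ := (powCoprime hc).surjective (Units.mk0 x hx)
  exact ⟨y, y.ne_zero, by simpa using congrArg Units.val hy⟩

/-- `x ↦ x^q` is a power of the Frobenius for which `q - 1` and `q + 1` are coprime to the order of
the multiplicative group. -/
structure CoprimeFrobenius (F : Type*) [Field F] [Fintype F] [CharP F 2] (q : ℕ) (σ : F →+* F) :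
    Prop where
  two_le : 2 ≤ q
  map_eq_pow : ∀ x, σ x = x ^ q
  coprime_pred : (q - 1).Coprime (Fintype.card F - 1)
  coprime_succ : (q + 1).Coprime (Fintype.card F - 1)
  exists_functional : ∃ l : F →+ ZMod 2, (∀ x, l (σ x) = l x) ∧
    ∀ x : F, x ≠ 0 → ∃ y, l (x * y) ≠ 0

theorem coprimeFrobenius_iterateFrobenius [CharP F 2] {m i : ℕ} (hm : Odd m) (hi : 0 < i)
    (hgcd : Nat.gcd i m = 1) (hF : Fintype.card F = 2 ^ m) :
    CoprimeFrobenius F (2 ^ i) (iterateFrobenius F 2 i) where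
  two_le := by simpa using Nat.pow_le_pow_right (n := 2) (by norm_num) hi
  map_eq_pow x := iterateFrobenius_def ..
  coprime_pred := by
    rw [hF, Nat.Coprime, Nat.pow_sub_one_gcd_pow_sub_one, hgcd]
    norm_num
  coprime_succ := by
    have h2 : Nat.gcd (2 * i) m = 1 :=
      Nat.Coprime.mul_left (Nat.coprime_two_left.mpr hm) hgcd
    have : (2 ^ (2 * i) - 1).Coprime (Fintype.card F - 1) := by
      rw [hF, Nat.Coprime, Nat.pow_sub_one_gcd_pow_sub_one, h2]
      norm_num
    refine this.coprime_dvd_left ⟨2 ^ i - 1, ?_⟩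
    rw [pow_mul', ← Nat.sq_sub_sq, one_pow]
  exists_functional := by
    let _ : Algebra (ZMod 2) F := ZMod.algebra F 2
    refine ⟨(Algebra.trace (ZMod 2) F).toAddMonoidHom, fun x => ?_, fun x hx => ?_⟩
    · clear hi hgcd
      induction i with
      | zero => simp
      | succ i ih =>
        rw [← ih, iterateFrobenius_def, iterateFrobenius_def, pow_succ, pow_mul]
        have := Algebra.trace_eq_of_algEquiv
          (FiniteField.frobeniusAlgEquivOfAlgebraic (ZMod 2) F) (x ^ 2 ^ i)
        simpa using this
    · have htr := (traceForm_nondegenerate (ZMod 2) F).1 x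
      simp_rw [Algebra.traceForm_apply] at htr
      by_contra! hf
      exact hx (htr hf)

namespace CoprimeFrobenius

variable [CharP F 2] {q : ℕ} {σ : F →+* F}

theorem map_eq_mul_pow (h : CoprimeFrobenius F q σ) (x : F) : σ x = x * x ^ (q - 1) := by
  rw [h.map_eq_pow, mul_comm, ← pow_succ, Nat.sub_add_cancel (by linarith [h.two_le])]

theorem exists_map_eq_mul (h : CoprimeFrobenius F q σ) {w : F} (hw : w ≠ 0) :
    ∃ x : F, x ≠ 0 ∧ σ x = x * w := by
  obtain ⟨x, hx, rfl⟩ := exists_pow_eq_of_coprime h.coprime_pred hw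
  exact ⟨x, hx, h.map_eq_mul_pow x⟩

theorem eq_zero_or_eq_one (h : CoprimeFrobenius F q σ) {x : F} (hx : σ x = x) : x = 0 ∨ x = 1 := by
  refine or_iff_not_imp_left.mpr fun h0 => pow_injOn_of_coprime h.coprime_pred h0 one_ne_zero ?_
  rw [one_pow]
  rw [h.map_eq_mul_pow] at hx
  exact mul_left_cancel₀ h0 (by rw [hx, mul_one])

theorem isAPN_gmap_and_isAPN_hmap (h : CoprimeFrobenius F q σ) {a : F} (ha : KernelFree σ a) :
    IsAPN (Gmap q a) ∧ IsAPN (Hmap q a) := by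
  obtain ⟨l, hlσ, hl⟩ := h.exists_functional
  obtain ⟨b, rfl⟩ := (Finite.injective_iff_surjective.mp σ.injective) a
  have hb : KernelFree σ b := by
    intro x hx hx'
    refine ha (σ x) (by simpa using hx) ?_
    simpa using congrArg σ hx'
  have hσ : ∀ w : F, w ≠ 0 → ∃ x : F, x ≠ 0 ∧ σ x = x * w := fun w => h.exists_map_eq_mul
  have hfix : ∀ x, σ x = x → x = 0 ∨ x = 1 := fun x => h.eq_zero_or_eq_one
  exact ⟨isAPN_gmap h.map_eq_pow (ha.no_root hσ) (ha.no_root_adjoint hσ l hlσ hl) hfix,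
    isAPN_hmap h.map_eq_pow (ha.no_root hσ) (hb.no_root_adjoint hσ l hlσ hl) hfix⟩

end CoprimeFrobenius

end Power

open Finset

namespace CoprimeFrobenius

variable {F : Type*} [Field F] [Fintype F] [CharP F 2] {q : ℕ} {σ : F →+* F}

theorem eq_or_eq_add_one (h : CoprimeFrobenius F q σ) {x y : F} (hxy : σ x + x = σ y + y) :
    x = y ∨ x = y + 1 := by
  have : σ (x + y) = x + y := by
    rw [map_add]
    grind
  rcases h.eq_zero_or_eq_one this with h0 | h0
  · left
    grind
  · right
    grind

variable [DecidableEq F]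

theorem card_filter_le_two_mul (h : CoprimeFrobenius F q σ) {A : F → F} {N : ℕ} (hN : 1 ≤ N)
    (hA : ∀ x, x ≠ 0 → A x = 0 →
      ∃ B : F → F, (∀ y, A (x * y) = B (σ y + y)) ∧ #{u | B u = 0} ≤ N) :
    #{x | A x = 0} ≤ 2 * N := by
  by_cases hx : ∃ x, x ≠ 0 ∧ A x = 0
  · obtain ⟨x, hx, hAx⟩ := hx
    obtain ⟨B, hB, hBN⟩ := hA x hx hAx
    refine le_trans ?_ (Nat.mul_le_mul_left 2 hBN)
    refine card_le_mul_card_image_of_maps_to (f := fun z => σ (z / x) + z / x) ?_ 2 ?_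
    · intro z hz
      simp only [mem_filter, mem_univ, true_and] at hz ⊢
      rw [← hB, mul_div_cancel₀ _ hx, hz]
    · intro u _
      rcases Finset.eq_empty_or_nonempty
        {z ∈ ({x | A x = 0} : Finset F) | σ (z / x) + z / x = u} with he | ⟨z, hz⟩
      · rw [he, card_empty]; exact Nat.zero_le 2
      · refine (card_le_card (t := {z, z + x}) ?_).trans card_le_two
        intro z' hz'
        simp only [mem_filter, mem_univ, true_and] at hz hz'
        rcases h.eq_or_eq_add_one (hz'.2.trans hz.2.symm) with h0 | h0
        · have : z' = z := by field_simp at h0; exact h0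
          simp [this]
        · have : z' = z + x := by field_simp at h0; exact h0
          simp [this]
  · push Not at hx
    refine (card_le_card (t := {0}) ?_).trans (by simp; omega)
    intro x hx'
    by_contra h0
    exact hx x (by simpa using h0) (by simpa using hx')

theorem card_roots_linear_le (h : CoprimeFrobenius F q σ) {c₁ : F} (c₀ : F) (hc : c₁ ≠ 0) :
    #{x | c₁ * σ x + c₀ * x = 0} ≤ 2 := by
  refine h.card_filter_le_two_mul (N := 1) le_rfl fun x hx hx0 =>
    ⟨fun u => c₁ * σ x * u, fun y => ?_, ?_⟩
  · simp only [map_mul]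
    grind
  · have : c₁ * σ x ≠ 0 := mul_ne_zero hc (by simpa using hx)
    simp [this, filter_eq']

theorem card_roots_quadratic_le (h : CoprimeFrobenius F q σ) {c₂ : F} (c₁ c₀ : F) (hc : c₂ ≠ 0) :
    #{x | c₂ * σ (σ x) + c₁ * σ x + c₀ * x = 0} ≤ 4 := by
  refine h.card_filter_le_two_mul (N := 2) (by norm_num) fun x hx hx0 =>
    ⟨fun u => c₂ * σ (σ x) * σ u + (c₁ * σ x + c₂ * σ (σ x)) * u, fun y => ?_, ?_⟩
  · simp only [map_mul, map_add]
    grind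
  · exact h.card_roots_linear_le _ (mul_ne_zero hc (by simpa using hx))

theorem card_roots_cubic_le (h : CoprimeFrobenius F q σ) {c₃ : F} (c₂ c₁ c₀ : F) (hc : c₃ ≠ 0) :
    #{x | c₃ * σ (σ (σ x)) + c₂ * σ (σ x) + c₁ * σ x + c₀ * x = 0} ≤ 8 := by
  refine h.card_filter_le_two_mul (N := 4) (by norm_num) fun x hx hx0 =>
    ⟨fun u => c₃ * σ (σ (σ x)) * σ (σ u) + (c₂ * σ (σ x) + c₃ * σ (σ (σ x))) * σ u +
      (c₁ * σ x + c₂ * σ (σ x) + c₃ * σ (σ (σ x))) * u, fun y => ?_, ?_⟩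
  · simp only [map_mul, map_add]
    grind
  · exact h.card_roots_quadratic_le _ _ (mul_ne_zero hc (by simpa using hx))

theorem card_nonzero_kernel_le (h : CoprimeFrobenius F q σ) (a : F) :
    #{x | x ≠ 0 ∧ σ (σ (σ x)) + a * σ (σ x) + x = 0} ≤ 7 := by
  have h8 := h.card_roots_cubic_le a 0 1 one_ne_zero
  have hlt : #{x | x ≠ 0 ∧ σ (σ (σ x)) + a * σ (σ x) + x = 0} <
      #{x | 1 * σ (σ (σ x)) + a * σ (σ x) + 0 * σ x + 1 * x = 0} := by
    refine card_lt_card ?_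
    rw [Finset.ssubset_iff_of_subset]
    · exact ⟨0, by simp, by simp⟩
    · intro x hx
      simp only [mem_filter, mem_univ, true_and] at hx ⊢
      linear_combination hx.2
  omega

open Classical in
/-- Counting the pairs of distinct nonzero roots of the polynomials `X^{q³} + a X^{q²} + X` bounds
the number of those without nonzero roots from below. -/
theorem card_pairs_le (h : CoprimeFrobenius F q σ) :
    7 + #{p : F × F | p.1 ≠ 0 ∧ p.2 ≠ 0 ∧ p.2 ≠ 1 ∧
      σ (σ (σ p.1)) * σ (σ (p.2 + σ p.2)) = p.1 * (p.2 + σ (σ p.2))} ≤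
    7 * #{a | KernelFree σ a} := by
  set α : F → F := fun x => (σ (σ (σ x)) + x) / σ (σ x) with hα
  have hαa : ∀ a x, x ≠ 0 → (α x = a ↔ σ (σ (σ x)) + a * σ (σ x) + x = 0) := by
    intro a x hx
    have : σ (σ x) ≠ 0 := by simpa using hx
    rw [hα]
    field_simp
    constructor <;> intro h' <;> grind
  set S : F → Finset F := fun a => {x | x ≠ 0 ∧ σ (σ (σ x)) + a * σ (σ x) + x = 0} with hS
  have hsum : ∑ a, #(S a) = Fintype.card F - 1 := by
    rw [← card_univ, ← card_erase_of_mem (mem_univ (0 : F)),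
      card_eq_sum_card_fiberwise (f := α) (t := univ) (fun _ _ => by simp)]
    refine sum_congr rfl fun a _ => congrArg card ?_
    ext x
    simp only [hS, mem_filter, mem_univ, true_and, mem_erase, and_true]
    exact and_congr_right fun hx => (hαa a x hx).symm
  have hpairs : #{p : F × F | p.1 ≠ 0 ∧ p.2 ≠ 0 ∧ p.2 ≠ 1 ∧
      σ (σ (σ p.1)) * σ (σ (p.2 + σ p.2)) = p.1 * (p.2 + σ (σ p.2))} ≤
      ∑ a, #(S a).offDiag := by
    rw [← card_sigma]
    refine card_le_card_of_injOn (fun p => ⟨α p.1, (p.1, p.2 * p.1)⟩) ?_ ?_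
    · rintro ⟨x, t⟩ hp
      simp only [coe_filter, mem_univ, true_and, Set.mem_ofPred_eq] at hp
      obtain ⟨hx, ht0, ht1, hxt⟩ := hp
      have e := (hαa (α x) x hx).mp rfl
      simp only [coe_sigma, Set.mem_sigma_iff, coe_univ, Set.mem_univ, true_and, mem_coe,
        mem_offDiag, hS, mem_filter, mem_univ]
      refine ⟨⟨hx, e⟩, ⟨mul_ne_zero ht0 hx, ?_⟩, ?_⟩
      · simp only [map_mul, map_add] at hxt ⊢
        grind
      · intro h0
        exact ht1 (mul_right_cancel₀ hx (by rw [one_mul, ← h0]))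
    · rintro ⟨x, t⟩ hp ⟨x', t'⟩ hp' heq
      simp only [coe_filter, mem_univ, true_and, Set.mem_ofPred_eq] at hp
      simp only [Sigma.mk.injEq, heq_eq_eq, Prod.mk.injEq] at heq
      obtain ⟨-, rfl, h2⟩ := heq
      rw [mul_right_cancel₀ hp.1 h2]
  have hpoint : ∀ a, 7 + #(S a).offDiag ≤ (if KernelFree σ a then 7 else 0) + 7 * #(S a) := by
    intro a
    have h7 : #(S a) ≤ 7 := h.card_nonzero_kernel_le a
    have hz : #(S a) = 0 → KernelFree σ a := by
      intro h0 x hx hx'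
      rw [card_eq_zero] at h0
      have : x ∈ S a := by simp [hS, hx, hx']
      rw [h0] at this
      simp at this
    rw [offDiag_card]
    by_cases h0 : #(S a) = 0
    · simp [h0, hz h0]
    · generalize #(S a) = n at h7 h0 ⊢
      split_ifs <;> interval_cases n <;> simp_all
  have htot := sum_le_sum fun a (_ : a ∈ (univ : Finset F)) => hpoint a
  rw [sum_add_distrib, sum_add_distrib, ← mul_sum, hsum, ← sum_filter, sum_const, sum_const,
    card_univ, smul_eq_mul, smul_eq_mul] at htot
  have := Fintype.card_pos (α := F)
  omega

end CoprimeFrobenius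

section HasseDeriv

open Polynomial

variable {F : Type*} [Field F]

theorem exists_pow_mul_hasseDeriv_pow (f : F[X]) (n v : ℕ) :
    ∃ C : F[X], C.natDegree ≤ v * f.natDegree ∧ f ^ v * hasseDeriv v (f ^ n) = f ^ n * C := by
  induction n generalizing v with
  | zero =>
    rcases Nat.eq_zero_or_pos v with rfl | hv
    · exact ⟨1, by simp⟩
    · exact ⟨0, by simp [hasseDeriv_apply_one v hv]⟩
  | succ n ih =>
    choose C hC using ih
    have hK : ∀ b, ∃ K : F[X], K.natDegree ≤ b * f.natDegree ∧
        f ^ b * hasseDeriv b f = f * K := by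
      rintro (_ | b)
      · exact ⟨1, by simp⟩
      · refine ⟨f ^ b * hasseDeriv (b + 1) f, ?_, by ring⟩
        refine natDegree_mul_le.trans ?_
        have h₁ : (f ^ b).natDegree ≤ b * f.natDegree := natDegree_pow_le
        have h₂ := natDegree_hasseDeriv_le f (b + 1)
        rw [add_mul]
        omega
    choose K hK using hK
    refine ⟨∑ p ∈ antidiagonal v, C p.1 * K p.2, ?_, ?_⟩
    · refine natDegree_sum_le_of_forall_le _ _ fun p hp => natDegree_mul_le.trans ?_
      rw [← mem_antidiagonal.mp hp, add_mul]
      exact add_le_add (hC _).1 (hK _).1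
    · rw [pow_succ, hasseDeriv_mul, mul_sum, mul_sum]
      refine sum_congr rfl fun p hp => ?_
      rw [← mem_antidiagonal.mp hp, pow_add]
      linear_combination (f ^ p.2 * hasseDeriv p.2 f) * (hC p.1).2 + f ^ n * C p.1 * (hK p.2).2

theorem exists_linearMap_pow_mul_hasseDeriv (f : F[X]) (n l : ℕ) :
    ∃ R : F[X] →ₗ[F] F[X], ∀ P : F[X], (R P).natDegree ≤ P.natDegree + l * f.natDegree ∧
      f ^ l * hasseDeriv l (P * f ^ n) = f ^ n * R P := by
  choose C hC using exists_pow_mul_hasseDeriv_pow f n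
  refine ⟨∑ p ∈ antidiagonal l, (LinearMap.mulLeft F (f ^ p.1 * C p.2)) ∘ₗ
    hasseDeriv p.1, fun P => ⟨?_, ?_⟩⟩
  · rw [LinearMap.sum_apply]
    refine natDegree_sum_le_of_forall_le _ _ fun p hp => ?_
    simp only [LinearMap.comp_apply, LinearMap.mulLeft_apply]
    refine natDegree_mul_le.trans ?_
    have h₁ : (f ^ p.1 * C p.2).natDegree ≤ p.1 * f.natDegree + p.2 * f.natDegree :=
      natDegree_mul_le.trans (add_le_add natDegree_pow_le (hC _).1)
    have h₂ := natDegree_hasseDeriv_le P p.1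
    rw [← mem_antidiagonal.mp hp, add_mul]
    omega
  · rw [LinearMap.sum_apply, hasseDeriv_mul, mul_sum, mul_sum]
    refine sum_congr rfl fun p hp => ?_
    simp only [LinearMap.comp_apply, LinearMap.mulLeft_apply]
    rw [← mem_antidiagonal.mp hp, pow_add]
    linear_combination (f ^ p.1 * hasseDeriv p.1 P) * (hC p.2).2

theorem hasseDeriv_mul_X_pow_card [Fintype F] (Z : F[X]) (k : ℕ) {l : ℕ}
    (hl : l < Fintype.card F) :
    hasseDeriv l (Z * X ^ (Fintype.card F * k)) =
      hasseDeriv l Z * X ^ (Fintype.card F * k) := by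
  induction k with
  | zero => simp
  | succ k ih =>
    rw [mul_add, mul_one, pow_add, ← mul_assoc, hasseDeriv_mul,
      sum_eq_single (l, 0), ih]
    · simp [mul_assoc]
    · rintro ⟨a, b⟩ hab hne
      have hsum : a + b = l := by simpa using hab
      have hb : b ≠ 0 := by
        rintro rfl
        simp_all
      obtain ⟨p, hp⟩ := CharP.exists F
      obtain ⟨n, hprime, hcard⟩ := FiniteField.card F p
      have hdvd : p ∣ (Fintype.card F).choose b := by
        rw [hcard]
        exact hprime.dvd_choose_pow hb (by rw [← hcard]; omega)
      rw [← monomial_one_right_eq_X_pow (Fintype.card F), hasseDeriv_monomial]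
      simp [(CharP.cast_eq_zero_iff F p _).mpr hdvd]
    · simp

theorem X_sub_C_pow_dvd_of_hasseDeriv_eval {Φ : F[X]} {x : F} {M : ℕ}
    (h : ∀ l < M, (hasseDeriv l Φ).eval x = 0) : (X - C x) ^ M ∣ Φ := by
  rw [X_sub_C_pow_dvd_iff, X_pow_dvd_iff]
  intro l hl
  have := taylor_coeff x Φ l
  rw [taylor_apply] at this
  rw [this, h l hl]

theorem mul_card_le_natDegree {Φ : F[X]} (hΦ : Φ ≠ 0) {S : Finset F} {M : ℕ}
    (h : ∀ x ∈ S, (X - C x) ^ M ∣ Φ) : M * #S ≤ Φ.natDegree := by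
  have hdvd : ∏ x ∈ S, (X - C x) ^ M ∣ Φ := by
    refine Finset.prod_dvd_of_coprime (fun x _ y _ hxy => ?_) h
    exact (pairwise_coprime_X_sub_C Function.injective_id hxy).pow
  refine le_trans (le_of_eq ?_) (natDegree_le_of_dvd hdvd hΦ)
  rw [natDegree_prod _ _ fun x _ => pow_ne_zero _ (X_sub_C_ne_zero x)]
  simp [mul_comm]

end HasseDeriv

section Stepanov

open Polynomial

variable {F : Type*} [Field F]

theorem exists_ne_zero_forall_sum_eq_zero {ι : Type*} [Fintype ι]
    (T : ℕ → ι → F[X] →ₗ[F] F[X]) {a M : ℕ} {N : ℕ → ℕ}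
    (hT : ∀ l i P, P ∈ degreeLT F a → T l i P ∈ degreeLT F (N l))
    (hdim : ∑ l ∈ range M, N l < Fintype.card ι * a) :
    ∃ P : ι → F[X], (∃ i, P i ≠ 0) ∧ (∀ i, P i ∈ degreeLT F a) ∧
      ∀ l < M, ∑ i, T l i (P i) = 0 := by
  let Ψ : (ι → degreeLT F a) →ₗ[F] ((Σ l : Fin M, Fin (N l)) → F) :=
    LinearMap.pi fun p => lcoeff F p.2 ∘ₗ
      ∑ i, T p.1 i ∘ₗ (degreeLT F a).subtype ∘ₗ LinearMap.proj i
  have : FiniteDimensional F (degreeLT F a) := (degreeLTEquiv F a).symm.finiteDimensional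
  have hker : LinearMap.ker Ψ ≠ ⊥ := by
    refine LinearMap.ker_ne_bot_of_finrank_lt ?_
    rw [Module.finrank_fintype_fun_eq_card, Module.finrank_pi_fintype,
      (degreeLTEquiv F a).finrank_eq, Module.finrank_fintype_fun_eq_card]
    simpa [Fin.sum_univ_eq_sum_range] using hdim
  obtain ⟨P, hP, hP0⟩ := Submodule.exists_mem_ne_zero_of_ne_bot hker
  obtain ⟨i, hi⟩ := Function.ne_iff.mp hP0
  refine ⟨fun i => P i, ⟨i, by simpa using hi⟩, fun i => (P i).2, fun l hl => ?_⟩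
  ext n
  by_cases hn : n < N l
  · have := congrFun (LinearMap.mem_ker.mp hP) ⟨⟨l, hl⟩, ⟨n, hn⟩⟩
    simpa [Ψ] using this
  · have hmem : ∑ i, T l i (P i) ∈ degreeLT F (N l) :=
      Submodule.sum_mem _ fun i _ => hT l i _ (P i).2
    rw [mem_degreeLT] at hmem
    exact coeff_eq_zero_of_degree_lt (hmem.trans_le (by exact_mod_cast not_lt.mp hn))

theorem stepanov_terms_degree_injective {Q D e a : ℕ} (he : 7 * e + 1 = Q)
    (hD : Nat.Coprime 7 D) (ha : 7 * a + 7 * D ≤ Q) {j j' k k' s s' : ℕ} (hj : j < 7)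
    (hj' : j' < 7) (hs : s < a) (hs' : s' < a)
    (h : s + e * j * D + Q * k = s' + e * j' * D + Q * k') : j = j' ∧ k = k' := by
  have hDpos : 0 < D := Nat.pos_of_ne_zero (by rintro rfl; simp at hD)
  have hjD : j * D ≤ 6 * D := Nat.mul_le_mul_right D (by omega)
  have hjD' : j' * D ≤ 6 * D := Nat.mul_le_mul_right D (by omega)
  have hcop : IsCoprime (7 : ℤ) D := Nat.isCoprime_iff_coprime.mpr hD
  zify at *
  have hmul : (Q : ℤ) * ((j * D + 7 * k) - (j' * D + 7 * k')) =
      7 * (s' - s) + (j * D - j' * D) := by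
    rw [← he] at h ⊢
    linear_combination 7 * h
  have hzero : (j * D + 7 * k : ℤ) - (j' * D + 7 * k') = 0 := by
    by_contra hne
    have h1 := Int.one_le_abs hne
    have h2 : |(Q : ℤ) * ((j * D + 7 * k) - (j' * D + 7 * k'))| < Q := by
      rw [hmul, abs_lt]
      have : (0 : ℤ) ≤ j * D := by positivity
      have : (0 : ℤ) ≤ j' * D := by positivity
      constructor <;> linarith
    rw [abs_mul, Nat.abs_cast] at h2
    nlinarith
  have hdvd : (7 : ℤ) ∣ (j - j') * D := ⟨k' - k, by linarith⟩
  have h7 : (7 : ℤ) ∣ j - j' :=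
    IsCoprime.dvd_of_dvd_mul_right hcop hdvd
  have hjj : (j : ℤ) = j' := by omega
  rw [hjj] at hzero
  exact ⟨hjj, by linarith⟩

/-- A Stepanov-type bound for the number of points at which a polynomial takes a nonzero seventh
power as its value. -/
theorem card_eval_pow_eq_one_le [Fintype F] [DecidableEq F] (f : F[X])
    (hD : Nat.Coprime 7 f.natDegree) {e : ℕ} (he : 7 * e + 1 = Fintype.card F)
    (hQ : 441 * f.natDegree ^ 2 + 182 * f.natDegree + 12 < 2 * Fintype.card F) :
    21 * #{x | f.eval x ^ e = 1} ≤ 5 * Fintype.card F := by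
  set Q := Fintype.card F with hQdef
  set D := f.natDegree with hDdef
  have hDpos : 0 < D := Nat.pos_of_ne_zero (by intro h0; simp [h0] at hD)
  have hf : f ≠ 0 := by
    rintro rfl
    simp [hDdef] at hDpos
  have hDQ : 21 * D ≤ Q := by nlinarith
  have hepos : e ≠ 0 := by
    rintro rfl
    omega
  obtain ⟨a, ha, ha'⟩ : ∃ a, 7 * a + 7 * D ≤ Q ∧ Q ≤ 7 * a + 7 * D + 6 :=
    ⟨Q / 7 - D, by omega, by omega⟩
  have hapos : 0 < a := by
    nlinarith
  choose R hR using exists_linearMap_pow_mul_hasseDeriv f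
  obtain ⟨P, ⟨i₀, hi₀⟩, hPdeg, hPsum⟩ := exists_ne_zero_forall_sum_eq_zero
    (ι := Fin 7 × Fin (4 * D)) (M := 21 * D) (a := a) (N := fun l => a + 4 * D + l * D)
    (fun l i => LinearMap.mulRight F (X ^ (i.2 : ℕ)) ∘ₗ R (e * i.1) l) (by
      intro l i P hP
      simp only [LinearMap.comp_apply, LinearMap.mulRight_apply, mem_degreeLT] at hP ⊢
      by_cases hz : R (e * i.1) l P * X ^ (i.2 : ℕ) = 0
      · rw [hz, degree_zero]
        exact WithBot.bot_lt_coe _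
      rw [degree_eq_natDegree hz]
      have h₁ := (hR (e * i.1) l P).1
      have h₂ : P.natDegree < a := by
        rcases eq_or_ne P 0 with rfl | h0
        · simpa using hapos
        · exact (natDegree_lt_iff_degree_lt h0).mpr hP
      have h₃ := natDegree_mul_le (p := R (e * i.1) l P) (q := X ^ (i.2 : ℕ))
      rw [natDegree_X_pow] at h₃
      rw [← hDdef] at h₁
      have := i.2.2
      exact_mod_cast (by omega : _ < a + 4 * D + l * D)) (by
      simp only [sum_add_distrib, sum_const, card_range, smul_eq_mul, ← sum_mul,
        Fintype.card_prod, Fintype.card_fin]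
      have hsum := sum_range_id_mul_two (21 * D)
      have : 2 * ∑ l ∈ range (21 * D), l ≤ 21 * D * (21 * D) := by
        rw [mul_comm, hsum]
        exact Nat.mul_le_mul_left _ (by omega)
      have h14 : D * (441 * D ^ 2 + 168 * D) < D * (14 * a) :=
        Nat.mul_lt_mul_of_pos_left (by omega) hDpos
      nlinarith)
  set t : Fin 7 × Fin (4 * D) → F[X] := fun i => P i * f ^ (e * i.1) * X ^ (Q * i.2) with ht
  have hP_lt : ∀ i, (P i).natDegree < a := by
    intro i
    by_cases h0 : P i = 0
    · simpa [h0] using hapos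
    · exact (natDegree_lt_iff_degree_lt h0).mpr (mem_degreeLT.mp (hPdeg i))
  have htdeg : ∀ i, t i ≠ 0 → (t i).natDegree = (P i).natDegree + e * i.1 * D + Q * i.2 := by
    intro i hi
    have hP0 : P i ≠ 0 := by
      intro h0
      simp [ht, h0] at hi
    rw [ht]
    simp only
    rw [natDegree_mul (mul_ne_zero hP0 (pow_ne_zero _ hf)) (pow_ne_zero _ X_ne_zero),
      natDegree_mul hP0 (pow_ne_zero _ hf), natDegree_pow, natDegree_X_pow]
  have hΦ : ∑ i, t i ≠ 0 := by
    have hdeg := degree_sum_eq_of_disjoint t univ (by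
      rintro i ⟨-, hi⟩ i' ⟨-, hi'⟩ hne heq
      refine hne ?_
      have hnat : (t i).natDegree = (t i').natDegree := natDegree_eq_of_degree_eq heq
      rw [htdeg i hi, htdeg i' hi'] at hnat
      obtain ⟨h₁, h₂⟩ := stepanov_terms_degree_injective he hD ha i.1.2 i'.1.2 (hP_lt i)
        (hP_lt i') hnat
      exact Prod.ext (Fin.ext h₁) (Fin.ext h₂))
    intro h0
    rw [h0, degree_zero, eq_comm, Finset.sup_eq_bot_iff] at hdeg
    have := degree_eq_bot.mp (hdeg i₀ (mem_univ _))
    exact mul_ne_zero (mul_ne_zero hi₀ (pow_ne_zero _ hf)) (pow_ne_zero _ X_ne_zero) this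
  have hroots := mul_card_le_natDegree hΦ (S := {x | f.eval x ^ e = 1}) (M := 21 * D) (by
    intro x hx
    have hx1 : f.eval x ^ e = 1 := by simpa using hx
    have hfx : f.eval x ≠ 0 := by
      intro h0
      simp [h0, hepos] at hx1
    refine X_sub_C_pow_dvd_of_hasseDeriv_eval fun l hl => ?_
    refine (mul_eq_zero_iff_left (pow_ne_zero l hfx)).mp ?_
    have hsum := congrArg (eval x) (hPsum l hl)
    rw [eval_zero, eval_finsetSum] at hsum
    rw [map_sum, eval_finsetSum, mul_sum, ← hsum]
    refine sum_congr rfl fun i _ => ?_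
    have hRi := congrArg (eval x) (hR (e * i.1) l (P i)).2
    simp only [eval_mul, eval_pow] at hRi
    simp only [ht, LinearMap.comp_apply, LinearMap.mulRight_apply]
    rw [hasseDeriv_mul_X_pow_card _ _ (by omega), eval_mul, eval_mul, eval_pow, eval_pow, eval_X,
      ← mul_assoc, hRi, pow_mul, hx1, one_pow, one_mul, pow_mul, FiniteField.pow_card])
  have hdegΦ : (∑ i, t i).natDegree ≤ a + 6 * e * D + Q * (4 * D - 1) := by
    refine natDegree_sum_le_of_forall_le _ _ fun i _ => ?_
    by_cases h0 : t i = 0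
    · simp [h0]
    · rw [htdeg i h0]
      have h₁ : e * i.1 * D ≤ 6 * e * D := by
        rw [mul_comm e]
        exact Nat.mul_le_mul_right _ (Nat.mul_le_mul_right _ (by omega))
      have h₂ : Q * (i.2 : ℕ) ≤ Q * (4 * D - 1) := Nat.mul_le_mul_left _ (by omega)
      have := hP_lt i
      omega
  have hbound : 21 * D * #{x | f.eval x ^ e = 1} ≤ 5 * D * Q := by
    refine (hroots.trans hdegΦ).trans ?_
    have h₁ : Q * (4 * D - 1) + Q = 4 * D * Q := by
      rw [← Nat.mul_succ, Nat.succ_eq_add_one, Nat.sub_add_cancel (by omega)]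
      ring
    have h₂ : 6 * e * D ≤ Q * D := Nat.mul_le_mul_right _ (by omega)
    nlinarith
  refine Nat.le_of_mul_le_mul_left ?_ hDpos
  nlinarith

end Stepanov

section Character

variable {F : Type*} [Field F] [Fintype F]

theorem norm_jacobiSum {χ ψ : MulChar F ℂ} (hχ : χ ≠ 1) (hψ : ψ ≠ 1) (hχψ : χ * ψ ≠ 1) :
    ‖jacobiSum χ ψ‖ = √(Fintype.card F : ℝ) := by
  have hchar : ringChar ℂ ≠ ringChar F := by
    rw [ringChar.eq_zero]
    exact (CharP.ringChar_ne_zero_of_finite F).symm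
  have h := jacobiSum_mul_jacobiSum_inv hchar hχ hψ hχψ
  have hconj : jacobiSum χ⁻¹ ψ⁻¹ = star (jacobiSum χ ψ) := by
    simp only [jacobiSum, star_sum, star_mul', MulChar.star_apply']
  rw [hconj, Complex.star_def, Complex.mul_conj, Complex.normSq_eq_norm_sq] at h
  rw [eq_comm, Real.sqrt_eq_iff_mul_self_eq (by positivity) (norm_nonneg _), ← sq]
  exact_mod_cast h.symm

theorem exists_mulChar_detecting {n e : ℕ} (he0 : e ≠ 0) (he : n * e + 1 = Fintype.card F) :
    ∃ χ : MulChar F ℂ, (∀ j, χ ^ j = 1 ↔ n ∣ j) ∧ ∀ x : F, x ≠ 0 → (χ x = 1 ↔ x ^ e = 1) := by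
  classical
  have hcard : Fintype.card F - 1 = n * e := by omega
  have hn : n ≠ 0 := by
    rintro rfl
    have := Fintype.one_lt_card (α := F)
    omega
  obtain ⟨χ, hχ⟩ := MulChar.exists_mulChar_orderOf F (hcard ▸ Dvd.intro e rfl)
    (Complex.isPrimitiveRoot_exp n hn)
  have hord : ∀ j, χ ^ j = 1 ↔ n ∣ j := fun j => by rw [← orderOf_dvd_iff_pow_eq_one, hχ]
  refine ⟨χ, hord, fun x hx => ?_⟩
  obtain ⟨g, hg⟩ := IsCyclic.exists_generator (α := Fˣ)
  obtain ⟨k, hk⟩ : ∃ k : ℕ, g ^ k = Units.mk0 x hx :=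
    (mem_powers_iff_mem_zpowers.mpr (hg (Units.mk0 x hx)))
  have hk' : x = (g : F) ^ k := by
    rw [← Units.val_pow_eq_pow_val, hk, Units.val_mk0]
  have h₁ : χ x = 1 ↔ n ∣ k := by
    rw [← hord k, MulChar.eq_iff hg, MulChar.pow_apply_coe, MulChar.one_apply_coe, hk', map_pow]
  have h₂ : x ^ e = 1 ↔ n ∣ k := by
    rw [hk', ← pow_mul, ← Units.val_pow_eq_pow_val, Units.val_eq_one,
      ← orderOf_dvd_iff_pow_eq_one, orderOf_eq_card_of_forall_mem_zpowers hg,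
      Nat.card_eq_fintype_card, Fintype.card_units, hcard]
    exact Nat.mul_dvd_mul_iff_right (Nat.pos_of_ne_zero he0)
  rw [h₁, h₂]

theorem abs_seven_mul_card_sub_le [DecidableEq F] {e n : ℕ} (he0 : e ≠ 0)
    (he : 7 * e + 1 = Fintype.card F) (hn : ¬ 7 ∣ n) (hn1 : ¬ 7 ∣ n + 1) :
    |7 * (#{x : F | x ≠ 0 ∧ x ≠ 1 ∧ (x ^ n * (1 - x)) ^ e = 1} : ℝ) - (Fintype.card F - 2)| ≤
      6 * √(Fintype.card F : ℝ) := by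
  obtain ⟨χ, hord, hχ⟩ := exists_mulChar_detecting he0 he
  have hgeom : ∀ x : F, x ≠ 0 →
      ∑ j ∈ range 7, (χ x) ^ j = if x ^ e = 1 then 7 else 0 := by
    intro x hx
    split_ifs with h1
    · simp [(hχ x hx).mpr h1]
    · have h7 : χ x ^ 7 = 1 := by
        rw [← MulChar.pow_apply' χ (by norm_num), (hord 7).mpr dvd_rfl,
          MulChar.one_apply hx.isUnit]
      have hne : χ x - 1 ≠ 0 := sub_ne_zero.mpr fun h0 => h1 ((hχ x hx).mp h0)
      have := mul_geom_sum (χ x) 7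
      rw [h7, sub_self] at this
      exact (mul_eq_zero.mp this).resolve_left hne
  have hpow : ∀ (j : ℕ) (x : F), x ≠ 0 → (χ ^ j) x = χ x ^ j := by
    intro j x hx
    exact MulChar.pow_apply_coe χ j (Units.mk0 x hx)
  have hcount : (7 * #{x : F | x ≠ 0 ∧ x ≠ 1 ∧ (x ^ n * (1 - x)) ^ e = 1} : ℂ) =
      ∑ j ∈ range 7, jacobiSum (χ ^ (n * j)) (χ ^ j) := by
    simp only [jacobiSum_eq_sum_sdiff]
    rw [sum_comm]
    have : ∀ x ∈ (univ \ {0, 1} : Finset F),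
        ∑ j ∈ range 7, (χ ^ (n * j)) x * (χ ^ j) (1 - x) =
          if (x ^ n * (1 - x)) ^ e = 1 then 7 else 0 := by
      intro x hx
      simp only [mem_sdiff, mem_univ, true_and, mem_insert, mem_singleton, not_or] at hx
      have hx1 : 1 - x ≠ 0 := sub_ne_zero.mpr (Ne.symm hx.2)
      rw [← hgeom _ (mul_ne_zero (pow_ne_zero n hx.1) hx1)]
      refine sum_congr rfl fun j _ => ?_
      rw [hpow _ _ hx.1, hpow _ _ hx1, map_mul, map_pow, mul_pow, pow_mul]
    rw [sum_congr rfl this, ← sum_filter, sum_const, nsmul_eq_mul, mul_comm]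
    congr 3
    ext x
    simp [and_assoc]
  rw [sum_range_succ'] at hcount
  simp only [mul_zero, pow_zero, jacobiSum_one_one] at hcount
  have hnorm : ‖∑ j ∈ range 6, jacobiSum (χ ^ (n * (j + 1))) (χ ^ (j + 1))‖ ≤
      6 * √(Fintype.card F : ℝ) := by
    refine (norm_sum_le_of_le _ (n := fun _ => √(Fintype.card F : ℝ)) fun j hj => ?_).trans
      (by simp)
    have hj7 : ¬ 7 ∣ j + 1 := by
      intro hdvd
      have := Nat.le_of_dvd (by omega) hdvd
      simp at hj
      omega
    have hp : Nat.Prime 7 := by norm_num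
    refine (norm_jacobiSum ?_ ?_ ?_).le
    · rw [Ne, hord, hp.dvd_mul]
      tauto
    · rwa [Ne, hord]
    · rw [← pow_add, Ne, hord, ← Nat.succ_mul, hp.dvd_mul]
      tauto
  refine le_trans (le_of_eq ?_) hnorm
  rw [← Real.norm_eq_abs, ← Complex.norm_real]
  congr 1
  push_cast
  linear_combination hcount

end Character

section Roots

variable {F : Type*} [Field F] [Fintype F]

/-- A root of unity of order dividing `e` is an `N`-th power as soon as `N` and the order of the
multiplicative group have greatest common divisor `n`, where `n * e` is that order. -/
theorem exists_pow_eq_of_gcd {n e N : ℕ} (he0 : e ≠ 0) (he : n * e + 1 = Fintype.card F)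
    (hN : N.gcd (Fintype.card F - 1) = n) {w : F} (hw : w ^ e = 1) :
    ∃ x : F, x ≠ 0 ∧ x ^ N = w := by
  classical
  have hw0 : w ≠ 0 := by
    rintro rfl
    simp [he0] at hw
  have hcard : Fintype.card F - 1 = n * e := by omega
  obtain ⟨g, hg⟩ := IsCyclic.exists_generator (α := Fˣ)
  have hord : orderOf g = n * e := by
    rw [orderOf_eq_card_of_forall_mem_zpowers hg, Nat.card_eq_fintype_card, Fintype.card_units,
      hcard]
  obtain ⟨k, hk⟩ : ∃ k : ℕ, g ^ k = Units.mk0 w hw0 :=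
    (mem_powers_iff_mem_zpowers.mpr (hg (Units.mk0 w hw0)))
  have hdvd : n ∣ k := by
    have : g ^ (k * e) = 1 := by
      rw [pow_mul, hk]
      ext
      simpa using hw
    rw [← orderOf_dvd_iff_pow_eq_one, hord] at this
    exact (Nat.mul_dvd_mul_iff_right (Nat.pos_of_ne_zero he0)).mp this
  obtain ⟨c, rfl⟩ := hdvd
  have hbez : (n : ℤ) = N * N.gcdA (n * e) + (n * e : ℕ) * N.gcdB (n * e) := by
    rw [← Nat.gcd_eq_gcd_ab, ← hcard, hN]
  have hgn : g ^ n = (g ^ N.gcdA (n * e)) ^ N := by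
    rw [← zpow_natCast g n, hbez, zpow_add, zpow_mul _ ((n * e : ℕ) : ℤ), zpow_natCast, ← hord,
      pow_orderOf_eq_one, one_zpow, mul_one, mul_comm, zpow_mul, zpow_natCast, hord]
  refine ⟨((g ^ N.gcdA (n * e)) ^ c : Fˣ), Units.ne_zero _, ?_⟩
  rw [← Units.val_pow_eq_pow_val, ← pow_mul, mul_comm c, pow_mul, ← hgn, ← pow_mul, hk,
    Units.val_mk0]

theorem exists_isPrimitiveRoot {n e : ℕ} (he : n * e + 1 = Fintype.card F) :
    ∃ ζ : F, IsPrimitiveRoot ζ n := by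
  classical
  obtain ⟨g, hg⟩ := IsCyclic.exists_generator (α := Fˣ)
  have hord : orderOf g = n * e := by
    rw [orderOf_eq_card_of_forall_mem_zpowers hg, Nat.card_eq_fintype_card, Fintype.card_units]
    omega
  have hζ := (IsPrimitiveRoot.orderOf g).pow (orderOf_pos g) (hord.trans (mul_comm n e))
  exact ⟨_, hζ.map_of_injective (f := Units.coeHom F) Units.val_injective⟩

theorem pow_mul_eq_one_of_dvd {n e k : ℕ} (he : n * e + 1 = Fintype.card F) (hk : n ∣ k) {x : F}
    (hx : x ≠ 0) : (x ^ k) ^ e = 1 := by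
  obtain ⟨c, rfl⟩ := hk
  rw [← pow_mul, mul_right_comm, pow_mul, show n * e = Fintype.card F - 1 by omega,
    FiniteField.pow_card_sub_one_eq_one x hx, one_pow]

end Roots

namespace CoprimeFrobenius

variable {F : Type*} [Field F] [Fintype F] [CharP F 2] {q : ℕ} {σ : F →+* F}

theorem map_map_map_eq_mul_pow (h : CoprimeFrobenius F q σ) (x : F) :
    σ (σ (σ x)) = x * x ^ (q ^ 3 - 1) := by
  rw [mul_comm, ← pow_succ, Nat.sub_add_cancel (Nat.one_le_pow _ _ (by linarith [h.two_le])),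
    h.map_eq_pow, h.map_eq_pow, h.map_eq_pow, ← pow_mul, ← pow_mul]
  ring_nf

theorem eq_zero_or_eq_one_of_map_map (h : CoprimeFrobenius F q σ) {x : F} (hx : σ (σ x) = x) :
    x = 0 ∨ x = 1 := by
  refine or_iff_not_imp_left.mpr fun h0 => pow_injOn_of_coprime
    (h.coprime_pred.mul_left h.coprime_succ) h0 one_ne_zero ?_
  rw [one_pow]
  refine mul_right_cancel₀ h0 ?_
  rw [h.map_eq_pow, h.map_eq_pow, ← pow_mul] at hx
  rw [one_mul, ← pow_succ]
  convert hx using 2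
  obtain ⟨k, rfl⟩ := Nat.exists_eq_add_of_le h.two_le
  simp only [show 2 + k - 1 = k + 1 by omega]
  ring

theorem add_map_ne_zero (h : CoprimeFrobenius F q σ) {t : F} (h0 : t ≠ 0) (h1 : t ≠ 1) :
    t + σ t ≠ 0 := by
  intro ht
  rcases h.eq_zero_or_eq_one (show σ t = t by grind) with h' | h'
  · exact h0 h'
  · exact h1 h'

theorem add_map_map_ne_zero (h : CoprimeFrobenius F q σ) {t : F} (h0 : t ≠ 0) (h1 : t ≠ 1) :
    t + σ (σ t) ≠ 0 := by
  intro ht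
  rcases h.eq_zero_or_eq_one_of_map_map (show σ (σ t) = t by grind) with h' | h'
  · exact h0 h'
  · exact h1 h'

theorem add_map_ne_one (h : CoprimeFrobenius F q σ) (t : F) : t + σ t ≠ 1 := by
  intro ht
  have hσt : σ t = t + 1 := by grind
  have : σ (σ t) = t := by
    rw [hσt, map_add, map_one, hσt]
    grind
  rcases h.eq_zero_or_eq_one_of_map_map this with rfl | rfl
  · simp at hσt
  · simp only [map_one] at hσt
    grind

/-- Every element is of the form `t + t^q` or `1 + t + t^q`. -/
theorem exists_add_map_eq (h : CoprimeFrobenius F q σ) (s : F) :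
    (∃ t, t + σ t = s) ∨ ∃ t, 1 + t + σ t = s := by
  classical
  let φ : Bool × F → F := fun p => (if p.1 then 1 else 0) + p.2 + σ p.2
  have hcard : #(univ : Finset (Bool × F)) ≤ 2 * #(univ.image φ) := by
    refine card_le_mul_card_image _ 2 fun b hb => ?_
    obtain ⟨⟨ε, t⟩, -, rfl⟩ := mem_image.mp hb
    refine (card_le_card (t := {(ε, t), (ε, t + 1)}) ?_).trans card_le_two
    rintro ⟨ε', t'⟩ hp
    simp only [mem_filter, mem_univ, true_and, φ] at hp
    have hε : ε' = ε := by
      have hone := h.add_map_ne_one (t + t')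
      rw [map_add] at hone
      cases ε <;> cases ε' <;> simp at hp ⊢ <;> exact hone (by grind)
    subst hε
    have := h.eq_or_eq_add_one (x := t') (y := t) (by grind)
    simpa using this
  rw [card_univ, Fintype.card_prod, Fintype.card_bool] at hcard
  have huniv : univ.image φ = univ := by
    refine eq_univ_of_card _ (le_antisymm (card_le_univ _) ?_)
    omega
  obtain ⟨⟨ε, t⟩, -, hs⟩ := mem_image.mp (huniv ▸ mem_univ s)
  cases ε
  · left
    exact ⟨t, by simpa [φ] using hs⟩
  · right
    exact ⟨t, by simpa [φ] using hs⟩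

variable [DecidableEq F]

theorem card_sub_two_le_card_pairs (h : CoprimeFrobenius F q σ)
    (hcop : (q ^ 3 - 1).Coprime (Fintype.card F - 1)) :
    Fintype.card F ≤ 2 + #{p : F × F | p.1 ≠ 0 ∧ p.2 ≠ 0 ∧ p.2 ≠ 1 ∧
      σ (σ (σ p.1)) * σ (σ (p.2 + σ p.2)) = p.1 * (p.2 + σ (σ p.2))} := by
  have hx : ∀ t : F, ∃ x : F, t ≠ 0 → t ≠ 1 → x ≠ 0 ∧
      σ (σ (σ x)) * σ (σ (t + σ t)) = x * (t + σ (σ t)) := by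
    intro t
    by_cases h0 : t = 0
    · exact ⟨0, fun h' => absurd h0 h'⟩
    by_cases h1 : t = 1
    · exact ⟨0, fun _ h' => absurd h1 h'⟩
    have hden : σ (σ (t + σ t)) ≠ 0 :=
      (map_ne_zero σ).mpr ((map_ne_zero σ).mpr (h.add_map_ne_zero h0 h1))
    obtain ⟨x, hx, hxw⟩ := exists_pow_eq_of_coprime hcop
      (div_ne_zero (h.add_map_map_ne_zero h0 h1) hden)
    refine ⟨x, fun _ _ => ⟨hx, ?_⟩⟩
    rw [h.map_map_map_eq_mul_pow, hxw]
    field_simp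
  choose x hx using hx
  have hcard : #(univ \ {0, 1} : Finset F) ≤ #{p : F × F | p.1 ≠ 0 ∧ p.2 ≠ 0 ∧ p.2 ≠ 1 ∧
      σ (σ (σ p.1)) * σ (σ (p.2 + σ p.2)) = p.1 * (p.2 + σ (σ p.2))} := by
    refine card_le_card_of_injOn (fun t => (x t, t)) (fun t ht => ?_) fun t _ t' _ htt' =>
      (Prod.ext_iff.mp htt').2
    simp only [coe_sdiff, coe_univ, coe_insert, coe_singleton, Set.mem_sdiff, Set.mem_univ,
      true_and, Set.mem_insert_iff, Set.mem_singleton_iff, not_or] at ht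
    have := hx t ht.1 ht.2
    simp only [coe_filter, mem_univ, true_and, Set.mem_ofPred_eq]
    exact ⟨this.1, ht.1, ht.2, this.2⟩
  rw [card_sdiff_of_subset (subset_univ _), card_univ] at hcard
  have : #({0, 1} : Finset F) ≤ 2 := card_le_two
  omega

theorem seven_mul_card_le_card_pairs (h : CoprimeFrobenius F q σ) {e : ℕ} (he0 : e ≠ 0)
    (he : 7 * e + 1 = Fintype.card F) (hN : (q ^ 3 - 1).gcd (Fintype.card F - 1) = 7) :
    7 * #{t : F | ((t + σ t + σ (t + σ t)) / σ (σ (t + σ t))) ^ e = 1} ≤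
      #{p : F × F | p.1 ≠ 0 ∧ p.2 ≠ 0 ∧ p.2 ≠ 1 ∧
        σ (σ (σ p.1)) * σ (σ (p.2 + σ p.2)) = p.1 * (p.2 + σ (σ p.2))} := by
  have hx : ∀ t : F, ∃ x : F, ((t + σ t + σ (t + σ t)) / σ (σ (t + σ t))) ^ e = 1 → x ≠ 0 ∧
      x ^ (q ^ 3 - 1) = (t + σ t + σ (t + σ t)) / σ (σ (t + σ t)) := by
    intro t
    by_cases ht : ((t + σ t + σ (t + σ t)) / σ (σ (t + σ t))) ^ e = 1
    · obtain ⟨x, hx⟩ := exists_pow_eq_of_gcd he0 he hN ht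
      exact ⟨x, fun _ => hx⟩
    · exact ⟨0, fun h' => absurd h' ht⟩
  choose x hx using hx
  obtain ⟨ζ, hζ⟩ := exists_isPrimitiveRoot he
  have hζN : ζ ^ (q ^ 3 - 1) = 1 := (hζ.pow_eq_one_iff_dvd _).mpr (hN ▸ Nat.gcd_dvd_left _ _)
  have hζ0 : ζ ≠ 0 := hζ.ne_zero (by norm_num)
  rw [← card_range 7, ← card_product]
  refine card_le_card_of_injOn (fun p => (x p.2 * ζ ^ p.1, p.2)) ?_ ?_
  · rintro ⟨j, t⟩ hp
    simp only [coe_product, coe_range, Set.mem_prod, Set.mem_Iio, coe_filter, mem_univ, true_and,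
      Set.mem_ofPred_eq] at hp ⊢
    obtain ⟨hx0, hxt⟩ := hx t hp.2
    have h0 : t ≠ 0 := by
      rintro rfl
      simp [he0] at hp
    have h1 : t ≠ 1 := by
      rintro rfl
      simp [he0, CharTwo.add_self_eq_zero] at hp
    have hden : σ (σ (t + σ t)) ≠ 0 :=
      (map_ne_zero σ).mpr ((map_ne_zero σ).mpr (h.add_map_ne_zero h0 h1))
    refine ⟨mul_ne_zero hx0 (pow_ne_zero _ hζ0), h0, h1, ?_⟩
    rw [h.map_map_map_eq_mul_pow, mul_pow, ← pow_mul, mul_comm j, pow_mul, hζN, one_pow, mul_one,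
      hxt, mul_assoc, div_mul_cancel₀ _ hden, map_add]
    grind
  · rintro ⟨j, t⟩ hp ⟨j', t'⟩ hp' heq
    simp only [coe_product, coe_range, Set.mem_prod, Set.mem_Iio, coe_filter, mem_univ, true_and,
      Set.mem_ofPred_eq] at hp hp'
    simp only [Prod.mk.injEq] at heq ⊢
    obtain ⟨heq, rfl⟩ := heq
    exact ⟨hζ.pow_inj hp.1 hp'.1 (mul_left_cancel₀ (hx t hp.2).1 heq), rfl⟩

/-- Splitting a set according to whether its elements are of the form `t + t^q` or
`1 + t + t^q`. -/
theorem two_mul_card_le (h : CoprimeFrobenius F q σ) (p : F → Prop) [DecidablePred p] :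
    2 * #{s | p s} ≤ #{t | p (t + σ t)} + #{t | p (1 + t + σ t)} := by
  choose! t ht using fun s (hs : ∃ t, t + σ t = s) => hs
  choose! t' ht' using fun s (hs : ∃ t, 1 + t + σ t = s) => hs
  classical
  have key : ∀ (c : F) (u : F → F) (S : Finset F), (∀ s ∈ S, p s) →
      (∀ s ∈ S, c + u s + σ (u s) = s) → 2 * #S ≤ #{t | p (c + t + σ t)} := by
    intro c u S hS hu
    rw [mul_comm, ← Fintype.card_bool, ← card_univ, ← card_product]
    refine card_le_card_of_injOn (fun z => u z.1 + if z.2 then 1 else 0) ?_ ?_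
    · rintro ⟨s, ε⟩ hz
      simp only [coe_product, Set.mem_prod, mem_coe, mem_univ, and_true] at hz
      have hus : c + (u s + if ε then 1 else 0) + σ (u s + if ε then 1 else 0) = s := by
        cases ε
        · simpa using hu s hz
        · have := hu s hz
          simp only [if_true, map_add, map_one]
          grind
      simp only [coe_filter, mem_univ, true_and, Set.mem_ofPred_eq, hus]
      exact hS s hz
    · rintro ⟨s, ε⟩ hz ⟨s', ε'⟩ hz' heq
      simp only [coe_product, Set.mem_prod, mem_coe, mem_univ, and_true] at hz hz'
      have e₁ := hu s hz
      have e₂ := hu s' hz'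
      have hss : s = s' := by
        have hσ := congrArg σ heq
        cases ε <;> cases ε' <;> simp at heq hσ <;> grind
      subst hss
      cases ε <;> cases ε' <;> simp at heq ⊢
  have h₁ := key 0 t {s | p s ∧ ∃ t, t + σ t = s} (by simp +contextual) (by
    intro s hs
    rw [zero_add]
    exact ht s (by simpa using (mem_filter.mp hs).2.2))
  have h₂ := key 1 t' {s | p s ∧ ¬ ∃ t, t + σ t = s} (by simp +contextual) (by
    intro s hs
    exact ht' s ((h.exists_add_map_eq s).resolve_left (mem_filter.mp hs).2.2))
  simp only [zero_add] at h₁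
  have hsplit := card_filter_add_card_filter_not (s := ({s | p s} : Finset F))
    (fun s => ∃ t, t + σ t = s)
  rw [filter_filter, filter_filter] at hsplit
  omega

end CoprimeFrobenius

namespace CoprimeFrobenius

variable {F : Type*} [Field F] [Fintype F] [DecidableEq F] [CharP F 2] {q : ℕ} {σ : F →+* F}

theorem card_pow_mul_one_sub_le (h : CoprimeFrobenius F q σ) {e : ℕ}
    (he : 7 * e + 1 = Fintype.card F) :
    #{x : F | x ≠ 0 ∧ x ≠ 1 ∧ (x ^ (6 * (q + 1)) * (1 - x)) ^ e = 1} ≤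
      #{s : F | ((s + σ s) / σ (σ s)) ^ e = 1} := by
  choose! u hu0 hu using fun w (hw : w ≠ 0) => h.exists_map_eq_mul hw
  refine card_le_card_of_injOn u (fun x hx => ?_) fun x hx x' hx' heq => ?_
  · simp only [coe_filter, mem_univ, true_and, Set.mem_ofPred_eq] at hx ⊢
    obtain ⟨hx0, -, hxe⟩ := hx
    have hs0 := hu0 x hx0
    have hratio : (u x + σ (u x)) / σ (σ (u x)) =
        x ^ (6 * (q + 1)) * (1 - x) / (x ^ (7 * (q + 1))) := by
      rw [hu x hx0, map_mul, hu x hx0, CharTwo.sub_eq_add, h.map_eq_pow x]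
      field_simp
      ring
    rw [hratio, div_pow, hxe, pow_mul_eq_one_of_dvd he (Dvd.intro _ rfl) hx0, div_one]
  · simp only [coe_filter, mem_univ, true_and, Set.mem_ofPred_eq] at hx hx'
    have e₁ := hu x hx.1
    rw [heq, hu x' hx'.1] at e₁
    exact (mul_left_cancel₀ (hu0 x' hx'.1) e₁).symm

theorem card_one_add_le (h : CoprimeFrobenius F q σ) {e : ℕ} (he0 : e ≠ 0)
    (he : 7 * e + 1 = Fintype.card F) (hd : 7 ∣ q ^ 2 + q + 1) :
    #{t : F | ((1 + t + σ t + σ (1 + t + σ t)) / σ (σ (1 + t + σ t))) ^ e = 1} ≤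
      #{r : F | (σ (r + σ r) * (r + r ^ 2)) ^ e = 1} := by
  have hne : ∀ t : F, ((1 + t + σ t + σ (1 + t + σ t)) / σ (σ (1 + t + σ t))) ^ e = 1 →
      t ≠ 0 ∧ t ≠ 1 ∧ 1 + t + σ t ≠ 0 := by
    intro t ht
    refine ⟨?_, ?_, ?_⟩
    · rintro rfl
      simp [he0, CharTwo.add_self_eq_zero] at ht
    · rintro rfl
      simp [he0, CharTwo.add_self_eq_zero] at ht
    · intro h0
      simp [he0, h0] at ht
  refine card_le_card_of_injOn (fun t => (1 + σ t) * (1 + t) / (1 + t + σ t)) ?_ ?_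
  · intro t ht
    simp only [coe_filter, mem_univ, true_and, Set.mem_ofPred_eq] at ht ⊢
    obtain ⟨ht0, ht1, hs0⟩ := hne t ht
    set s := 1 + t + σ t with hs
    set v := t + t ^ 2 with hv
    have hv0 : v ≠ 0 := by
      intro h0
      have : t * (1 + t) = 0 := by rw [← h0, hv]; ring
      rcases mul_eq_zero.mp this with h' | h'
      · exact ht0 h'
      · exact ht1 (by grind)
    have hσs : σ s ≠ 0 := (map_ne_zero σ).mpr hs0
    have hσσs : σ (σ s) ≠ 0 := (map_ne_zero σ).mpr hσs
    have hσσσs : σ (σ (σ s)) ≠ 0 := (map_ne_zero σ).mpr hσσs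
    set r := (1 + σ t) * (1 + t) / s with hr
    have hσv : σ v = σ t + σ t ^ 2 := by rw [hv, map_add, map_pow]
    have hr2 : r + r ^ 2 = σ v * v / s ^ 2 := by
      rw [hr, hσv]
      field_simp
      grind
    have hrσ : r + σ r = σ v * (s + σ s) / (s * σ s) := by
      rw [hr, hσv, map_div₀]
      simp only [map_mul, map_add, map_one]
      have : σ s = 1 + σ t + σ (σ t) := by rw [hs]; simp
      field_simp
      grind
    have hpow : ∀ x : F, σ (σ x) * σ x * x = x ^ (q ^ 2 + q + 1) := by
      intro x
      simp only [h.map_eq_pow]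
      ring
    have hfr : σ (r + σ r) * (r + r ^ 2) = v ^ (q ^ 2 + q + 1) *
        σ ((s + σ s) / σ (σ s)) * (s ^ (q ^ 3 - 1) / s ^ (q ^ 2 + q + 1)) := by
      have hs3 : s ^ (q ^ 3 - 1) = σ (σ (σ s)) / s := by
        rw [h.map_map_map_eq_mul_pow]
        field_simp
      rw [hs3, hr2, hrσ, ← hpow, ← hpow]
      simp only [map_div₀, map_mul, map_add]
      field_simp
    have hdvd : 7 ∣ q ^ 3 - 1 := by
      refine hd.trans ⟨q - 1, ?_⟩
      obtain ⟨k, rfl⟩ := Nat.exists_eq_add_of_le h.two_le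
      rw [show 2 + k - 1 = k + 1 by omega, Nat.sub_eq_iff_eq_add (Nat.one_le_pow _ _ (by omega))]
      ring
    rw [hfr, mul_pow, mul_pow, div_pow, pow_mul_eq_one_of_dvd he hd hv0,
      pow_mul_eq_one_of_dvd he hd hs0, pow_mul_eq_one_of_dvd he hdvd hs0, ← map_pow, ht]
    simp
  · intro t ht t' ht' heq
    simp only [coe_filter, mem_univ, true_and, Set.mem_ofPred_eq] at ht ht' heq
    obtain ⟨ht0, ht1, hs0⟩ := hne t ht
    obtain ⟨ht0', ht1', hs0'⟩ := hne t' ht'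
    have h1 : ∀ x : F, x ≠ 1 → 1 + x ≠ 0 := fun x hx h0 => hx (by grind)
    have hpow : ((1 + t) * t') ^ (q + 1) = ((1 + t') * t) ^ (q + 1) := by
      rw [pow_succ, pow_succ, ← h.map_eq_pow, ← h.map_eq_pow]
      simp only [map_mul, map_add, map_one]
      field_simp at heq
      grind
    have := pow_injOn_of_coprime h.coprime_succ (mul_ne_zero (h1 t ht1) ht0')
      (mul_ne_zero (h1 t' ht1') ht0) hpow
    grind

open Classical in
/-- The lower bound for the number of kernel-free parameters in terms of seventh-power values. -/
theorem card_kernelFree_lower_bound (h : CoprimeFrobenius F q σ) {e : ℕ} (he0 : e ≠ 0)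
    (he : 7 * e + 1 = Fintype.card F) (hN : (q ^ 3 - 1).gcd (Fintype.card F - 1) = 7)
    (hd : 7 ∣ q ^ 2 + q + 1) (hq : ¬ 7 ∣ q + 1) (hq' : ¬ 7 ∣ 6 * (q + 1) + 1) :
    7 + 2 * ((Fintype.card F : ℝ) - 2 - 6 * √(Fintype.card F : ℝ)) ≤
      7 * (#{a | KernelFree σ a} : ℝ) +
        7 * (#{r : F | (σ (r + σ r) * (r + r ^ 2)) ^ e = 1} : ℝ) := by
  have h₁ := h.card_pairs_le
  have h₂ := h.seven_mul_card_le_card_pairs he0 he hN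
  have h₃ := h.two_mul_card_le fun s => ((s + σ s) / σ (σ s)) ^ e = 1
  have h₄ := h.card_one_add_le he0 he hd
  have h₅ := h.card_pow_mul_one_sub_le he
  have h₆ := abs_le.mp (abs_seven_mul_card_sub_le (n := 6 * (q + 1)) he0 he (by omega) hq')
  have h₇ : 7 + 2 * (7 * #{x : F | x ≠ 0 ∧ x ≠ 1 ∧ (x ^ (6 * (q + 1)) * (1 - x)) ^ e = 1}) ≤
      7 * #{a | KernelFree σ a} + 7 * #{r : F | (σ (r + σ r) * (r + r ^ 2)) ^ e = 1} := by
    omega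
  have h₈ : (7 : ℝ) + 2 * (7 * #{x : F | x ≠ 0 ∧ x ≠ 1 ∧
      (x ^ (6 * (q + 1)) * (1 - x)) ^ e = 1}) ≤
      7 * #{a | KernelFree σ a} + 7 * #{r : F | (σ (r + σ r) * (r + r ^ 2)) ^ e = 1} := by
    exact_mod_cast h₇
  linarith [h₆.1]

theorem card_values_le_of_two (h : CoprimeFrobenius F 2 σ) {e : ℕ} (he0 : e ≠ 0)
    (he : 7 * e + 1 = Fintype.card F) :
    7 * (#{r : F | (σ (r + σ r) * (r + r ^ 2)) ^ e = 1} : ℝ) ≤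
      Fintype.card F - 2 + 6 * √(Fintype.card F : ℝ) := by
  have hle : #{r : F | (σ (r + σ r) * (r + r ^ 2)) ^ e = 1} ≤
      #{x : F | x ≠ 0 ∧ x ≠ 1 ∧ (x ^ 1 * (1 - x)) ^ e = 1} := by
    refine card_le_card fun r hr => ?_
    simp only [mem_filter, mem_univ, true_and] at hr ⊢
    have hr0 : r ≠ 0 := by
      rintro rfl
      simp [he0] at hr
    have hr1 : r ≠ 1 := by
      rintro rfl
      simp [he0, CharTwo.add_self_eq_zero] at hr
    refine ⟨hr0, hr1, ?_⟩
    have hu : r ^ 1 * (1 - r) ≠ 0 :=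
      mul_ne_zero (pow_ne_zero _ hr0) (sub_ne_zero.mpr (Ne.symm hr1))
    have hr3 : σ (r + σ r) * (r + r ^ 2) = (r ^ 1 * (1 - r)) ^ 3 := by
      rw [h.map_eq_pow, h.map_eq_pow]
      grind
    rw [hr3] at hr
    have h7 := pow_mul_eq_one_of_dvd he dvd_rfl hu
    rw [pow_right_comm] at hr h7
    generalize (r ^ 1 * (1 - r)) ^ e = y at hr h7 ⊢
    calc y = y ^ 7 / (y ^ 3) ^ 2 := by
          have : y ≠ 0 := by
            rintro rfl
            simp at hr
          field_simp
      _ = 1 := by rw [h7, hr]; simp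
  have hJ := abs_le.mp (abs_seven_mul_card_sub_le (n := 1) he0 he (by norm_num) (by norm_num))
  have : (#{r : F | (σ (r + σ r) * (r + r ^ 2)) ^ e = 1} : ℝ) ≤
      #{x : F | x ≠ 0 ∧ x ≠ 1 ∧ (x ^ 1 * (1 - x)) ^ e = 1} := by exact_mod_cast hle
  linarith [hJ.2]

open Polynomial in
theorem card_values_le (h : CoprimeFrobenius F q σ) {e : ℕ}
    (he : 7 * e + 1 = Fintype.card F) (hq : Nat.Coprime 7 (q ^ 2 + 2))
    (hQ : 441 * (q ^ 2 + 2) ^ 2 + 182 * (q ^ 2 + 2) + 12 < 2 * Fintype.card F) :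
    21 * #{r : F | (σ (r + σ r) * (r + r ^ 2)) ^ e = 1} ≤ 5 * Fintype.card F := by
  set f : F[X] := (X ^ q + X) ^ q * (X ^ 2 + X) with hf
  have hdeg : f.natDegree = q ^ 2 + 2 := by
    have h₁ : ∀ n, 2 ≤ n → (X ^ n + X : F[X]).natDegree = n := by
      intro n hn
      rw [natDegree_add_eq_left_of_natDegree_lt] <;> rw [natDegree_X_pow]
      rw [natDegree_X]
      omega
    have h₂ : ∀ n, 2 ≤ n → (X ^ n + X : F[X]) ≠ 0 := by
      intro n hn h0
      have := h₁ n hn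
      rw [h0, natDegree_zero] at this
      omega
    rw [hf, natDegree_mul (pow_ne_zero _ (h₂ q h.two_le)) (h₂ 2 le_rfl), natDegree_pow,
      h₁ q h.two_le, h₁ 2 le_rfl, sq]
  have hmain := card_eval_pow_eq_one_le f (by rwa [hdeg]) he (by rwa [hdeg])
  convert hmain using 6 with r
  simp only [hf, h.map_eq_pow, eval_mul, eval_pow, eval_add, eval_X]
  ring

end CoprimeFrobenius

theorem KernelFree.ne_zero {F : Type*} [Field F] [CharP F 2] {σ : F →+* F} {a : F}
    (h : KernelFree σ a) : a ≠ 0 := by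
  rintro rfl
  apply h 1 one_ne_zero
  simp [CharTwo.add_self_eq_zero]

/-- The residues of `2 ^ i` modulo `7` when `3 ∤ i`. -/
theorem two_pow_mod_seven {i : ℕ} (hi : ¬ 3 ∣ i) : 2 ^ i % 7 = 2 ∨ 2 ^ i % 7 = 4 := by
  have h : 2 ^ i % 7 = 2 ^ (i % 3) % 7 := by
    conv_lhs => rw [← Nat.div_add_mod i 3, pow_add, pow_mul, Nat.mul_mod, Nat.pow_mod]
    norm_num
  have : i % 3 = 1 ∨ i % 3 = 2 := by omega
  rcases this with h' | h' <;> simp [h, h']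

theorem exists_seven_mul_add_one_eq_two_pow {m : ℕ} (hm : 3 ≤ m) (h3 : 3 ∣ m) :
    ∃ e : ℕ, e ≠ 0 ∧ 7 * e + 1 = 2 ^ m := by
  obtain ⟨k, rfl⟩ := h3
  obtain ⟨e, he⟩ : 7 ∣ 2 ^ (3 * k) - 1 := by
    simpa [pow_mul] using Nat.sub_dvd_pow_sub_pow 8 1 k
  have h8 : 2 ^ 3 ≤ 2 ^ (3 * k) := Nat.pow_le_pow_right (by norm_num) hm
  exact ⟨e, by omega, by omega⟩

namespace CoprimeFrobenius

variable {F : Type*} [Field F] [Fintype F] [CharP F 2] {q : ℕ} {σ : F →+* F}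

open Classical in
theorem card_kernelFree_le_ncard (h : CoprimeFrobenius F q σ) :
    #{a | KernelFree σ a} ≤ {a : F | a ≠ 0 ∧ IsAPN (Gmap q a) ∧ IsAPN (Hmap q a)}.ncard := by
  rw [← Set.ncard_coe_finset]
  refine Set.ncard_le_ncard (fun a ha => ?_) (Set.toFinite _)
  have ha' : KernelFree σ a := by simpa using ha
  exact ⟨ha'.ne_zero, h.isAPN_gmap_and_isAPN_hmap ha'⟩

open Classical in
theorem card_add_five_le (h : CoprimeFrobenius F q σ)
    (hcop : (q ^ 3 - 1).Coprime (Fintype.card F - 1)) :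
    Fintype.card F + 5 ≤ 7 * #{a | KernelFree σ a} := by
  have h₁ := h.card_pairs_le
  have h₂ := h.card_sub_two_le_card_pairs hcop
  omega

end CoprimeFrobenius

theorem stmt_17 (m i : ℕ) (hm : 3 ≤ m) (hmodd : Odd m) (hi : 0 < i)
    (hgcd : Nat.gcd i m = 1) (q d : ℕ) (hq : q = 2 ^ i) (hd : d = q ^ 2 + q + 1)
    (F : Type*) [Field F] [Fintype F] (hF : Fintype.card F = 2 ^ m) :
    ((2 : ℝ) ^ m + 1 - ((d : ℝ) - 1) * ((d : ℝ) - 2) * Real.sqrt ((2 : ℝ) ^ m)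
        - (d : ℝ)) / (d : ℝ) ≤
      ({a : F | a ≠ 0 ∧ IsAPN (Gmap q a) ∧ IsAPN (Hmap q a)}.ncard : ℝ) := by
  classical
  have : Fact (Nat.Prime 2) := ⟨Nat.prime_two⟩
  have : CharP F 2 := charP_of_card_eq_prime_pow hF
  have h := coprimeFrobenius_iterateFrobenius hmodd hi hgcd hF
  rw [← hq] at h
  have hNcard : (#{a | KernelFree (iterateFrobenius F 2 i) a} : ℝ) ≤
      {a : F | a ≠ 0 ∧ IsAPN (Gmap q a) ∧ IsAPN (Hmap q a)}.ncard := by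
    exact_mod_cast h.card_kernelFree_le_ncard
  refine le_trans ?_ hNcard
  have hFR : (2 : ℝ) ^ m = (Fintype.card F : ℝ) := by rw [hF]; norm_num
  have hd7 : 7 ≤ d := by nlinarith [h.two_le]
  have hd7' : (7 : ℝ) ≤ d := by exact_mod_cast hd7
  rw [hFR, div_le_iff₀ (by linarith)]
  set N := (#{a | KernelFree (iterateFrobenius F 2 i) a} : ℝ) with hN
  have hN0 : 0 ≤ N := Nat.cast_nonneg _
  have hs0 := Real.sqrt_nonneg (Fintype.card F : ℝ)
  have hss : √(Fintype.card F : ℝ) * √(Fintype.card F : ℝ) = Fintype.card F :=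
    Real.mul_self_sqrt (Nat.cast_nonneg _)
  have hgcd' : (q ^ 3 - 1).gcd (Fintype.card F - 1) = 2 ^ Nat.gcd 3 m - 1 := by
    rw [hq, ← pow_mul, hF, Nat.pow_sub_one_gcd_pow_sub_one,
      Nat.Coprime.gcd_mul_left_cancel 3 hgcd]
  by_cases h3 : 3 ∣ m
  · rw [Nat.gcd_eq_left h3] at hgcd'
    obtain ⟨e, he0, he⟩ := exists_seven_mul_add_one_eq_two_pow hm h3
    rw [← hF] at he
    have hi3 : ¬ 3 ∣ i := fun h' => by simpa [hgcd] using Nat.dvd_gcd h' h3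
    have hq7 := two_pow_mod_seven hi3
    rw [← hq] at hq7
    have hsq : q ^ 2 % 7 = (q % 7) ^ 2 % 7 := Nat.pow_mod ..
    have hlow := h.card_kernelFree_lower_bound he0 he (by simpa using hgcd')
      (by rcases hq7 with h7 | h7 <;> rw [h7] at hsq <;> omega) (by omega) (by omega)
    rw [← hN] at hlow
    rcases h.two_le.eq_or_lt with h2 | h2
    · subst h2
      have hup := h.card_values_le_of_two he0 he
      subst hd
      norm_num at hd7' ⊢
      linarith
    · have hq4 : 4 ≤ q := by
        by_contra hlt
        have : q = 3 := by omega
        omega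
      have hd21 : 21 ≤ d := by nlinarith
      have hd21' : (21 : ℝ) ≤ d := by exact_mod_cast hd21
      rcases le_or_gt √(Fintype.card F : ℝ) ((d - 1) * (d - 2)) with hle | hlt
      · nlinarith [mul_nonneg hN0 (by linarith : (0 : ℝ) ≤ d)]
      · have hbig : ((d : ℝ) - 1) * (d - 2) * ((d - 1) * (d - 2)) < Fintype.card F := by
          rw [← hss]
          exact mul_self_lt_mul_self (by nlinarith) hlt
        have hD : (q : ℝ) ^ 2 + 2 ≤ d - 3 := by
          have : q ^ 2 + 5 ≤ d := by omega
          have : (q : ℝ) ^ 2 + 5 ≤ d := by exact_mod_cast this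
          linarith
        have hQ : 441 * (q ^ 2 + 2) ^ 2 + 182 * (q ^ 2 + 2) + 12 < 2 * Fintype.card F := by
          have h₁ : 400 * ((d : ℝ) - 2) ^ 2 ≤ (d - 1) * (d - 2) * ((d - 1) * (d - 2)) := by
            have : (20 : ℝ) ^ 2 ≤ (d - 1) ^ 2 := by gcongr; linarith
            nlinarith [sq_nonneg ((d : ℝ) - 2)]
          have h₂ : ((q : ℝ) ^ 2 + 2) ^ 2 ≤ (d - 3) ^ 2 := by gcongr
          have : 441 * ((q : ℝ) ^ 2 + 2) ^ 2 + 182 * (q ^ 2 + 2) + 12 < 2 * Fintype.card F := by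
            nlinarith
          exact_mod_cast this
        have hup : (21 * #{r : F | (iterateFrobenius F 2 i (r + iterateFrobenius F 2 i r) *
            (r + r ^ 2)) ^ e = 1} : ℝ) ≤ 5 * Fintype.card F := by
          refine mod_cast h.card_values_le he ?_ hQ
          rw [Nat.Prime.coprime_iff_not_dvd (by norm_num)]
          rcases hq7 with h7 | h7 <;> rw [h7] at hsq <;> omega
        have h36 : 36 * √(Fintype.card F : ℝ) ≤
            ((d : ℝ) - 1) * (d - 2) * √(Fintype.card F : ℝ) := by
          gcongr
          nlinarith
        nlinarith [mul_le_mul_of_nonneg_left hd21' hN0]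
  · rw [((Nat.Prime.coprime_iff_not_dvd Nat.prime_three).mpr h3 : Nat.gcd 3 m = 1)] at hgcd'
    have hlow : (Fintype.card F : ℝ) + 5 ≤ 7 * N := by
      rw [hN]
      exact_mod_cast h.card_add_five_le (by simpa using hgcd')
    have h₁ : 0 ≤ ((d : ℝ) - 1) * (d - 2) * √(Fintype.card F : ℝ) :=
      mul_nonneg (mul_nonneg (by linarith) (by linarith)) hs0
    nlinarith [mul_le_mul_of_nonneg_left hd7' hN0]
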